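/- arXiv:2210.09901 — 4 statements merged into one kernel-verified Lean document; each statement's English description precedes it below -/
import Mathlib

section
/- Let d ≥ 1, let π : ℝ^d → (0,∞) be a twice continuously differentiable positive integrable function whose Laplacian Δπ is Lebesgue-integrable with ∫_{ℝ^d} Δπ(x) dx = 0, let μ : ℝ^d → [0,∞) be an integrable probability density (∫ μ = 1), and let C > 0. Define the regeneration rate κ(x) := Δπ(x)/(2π(x)) + C μ(x)/π(x). Then for every compactly supported C² function f : ℝ^d → ℝ, ∫_{ℝ^d} [ (1/2)Δf(x) + κ(x) ( ∫_{ℝ^d} f(y) μ(y) dy − f(x) ) ] π(x) dx = 0. That is, π integrates the formal generator of the regeneration-enriched Brownian motion to zero. -/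
open MeasureTheory

/-- The Laplacian of `f : ℝ^d → ℝ`: the sum of the second partial derivatives. -/
noncomputable def lap {d : ℕ} (f : EuclideanSpace ℝ (Fin d) → ℝ)
    (x : EuclideanSpace ℝ (Fin d)) : ℝ :=
  ∑ i : Fin d, fderiv ℝ (fun y => fderiv ℝ f y (EuclideanSpace.single i 1)) x
    (EuclideanSpace.single i 1)

section IntegrationByParts

variable {E : Type*} [NormedAddCommGroup E] [NormedSpace ℝ E] {f g : E → ℝ}

/-- The directional derivative of a `C²` function is `C¹`. -/
lemma ContDiff.fderiv_apply_const_of_two (hf : ContDiff ℝ 2 f) (v : E) :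
    ContDiff ℝ 1 (fun y => fderiv ℝ f y v) :=
  (hf.fderiv_right (m := 1) (by norm_num)).clm_apply contDiff_const

/-- The directional derivative of a `C¹` function is continuous. -/
lemma ContDiff.continuous_fderiv_apply_const (hf : ContDiff ℝ 1 f) (v : E) :
    Continuous (fun y => fderiv ℝ f y v) :=
  (hf.continuous_fderiv one_ne_zero).clm_apply continuous_const

variable [FiniteDimensional ℝ E] [MeasurableSpace E] [BorelSpace E]
  (ν : Measure E) [ν.IsAddHaarMeasure]

/-- Integration by parts for `C¹` functions, the first of which has compact support. -/
lemma integral_mul_fderiv_eq_neg_of_hasCompactSupport (hf : ContDiff ℝ 1 f)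
    (hg : ContDiff ℝ 1 g) (hfc : HasCompactSupport f) (v : E) :
    ∫ x, f x * fderiv ℝ g x v ∂ν = -∫ x, fderiv ℝ f x v * g x ∂ν := by
  have hfc' : HasCompactSupport (fun x => fderiv ℝ f x v) := hfc.fderiv_apply ℝ v
  refine integral_mul_fderiv_eq_neg_fderiv_mul_of_integrable ?_ ?_ ?_
    (fun x _ => hf.differentiable one_ne_zero x) (fun x _ => hg.differentiable one_ne_zero x)
  · exact ((hf.continuous_fderiv_apply_const v).mul hg.continuous).integrable_of_hasCompactSupport
      hfc'.mul_right
  · exact (hf.continuous.mul (hg.continuous_fderiv_apply_const v)).integrable_of_hasCompactSupport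
      hfc.mul_right
  · exact (hf.continuous.mul hg.continuous).integrable_of_hasCompactSupport hfc.mul_right

/-- Moving a second directional derivative from a compactly supported `C²` function to another
`C²` function. -/
lemma integral_fderiv_fderiv_mul_of_hasCompactSupport (hf : ContDiff ℝ 2 f)
    (hg : ContDiff ℝ 2 g) (hfc : HasCompactSupport f) (v : E) :
    ∫ x, fderiv ℝ (fun y => fderiv ℝ f y v) x v * g x ∂ν
      = ∫ x, f x * fderiv ℝ (fun y => fderiv ℝ g y v) x v ∂ν := by
  rw [integral_mul_fderiv_eq_neg_of_hasCompactSupport ν (hf.of_le one_le_two)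
      (hg.fderiv_apply_const_of_two v) hfc v,
    integral_mul_fderiv_eq_neg_of_hasCompactSupport ν (hf.fderiv_apply_const_of_two v)
      (hg.of_le one_le_two) (hfc.fderiv_apply ℝ v) v, neg_neg]

end IntegrationByParts

section Laplacian

variable {d : ℕ} {f g : EuclideanSpace ℝ (Fin d) → ℝ}

lemma continuous_lap (hf : ContDiff ℝ 2 f) : Continuous (lap f) :=
  continuous_finsetSum _ fun _ _ =>
    (hf.fderiv_apply_const_of_two _).continuous_fderiv_apply_const _

lemma hasCompactSupport_lap (hfc : HasCompactSupport f) : HasCompactSupport (lap f) := by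
  refine hfc.mono' fun x hx => ?_
  by_contra hxf
  refine hx (Finset.sum_eq_zero fun i _ => ?_)
  have hsub := (tsupport_fderiv_apply_subset ℝ (f := fun y => fderiv ℝ f y
    (EuclideanSpace.single i 1)) (EuclideanSpace.single i (1 : ℝ))).trans
    (tsupport_fderiv_apply_subset ℝ (EuclideanSpace.single i (1 : ℝ)))
  exact image_eq_zero_of_notMem_tsupport
    (f := fun x => fderiv ℝ (fun y => fderiv ℝ f y (EuclideanSpace.single i 1)) x
      (EuclideanSpace.single i 1)) fun h => hxf (hsub h)

/-- Green's second identity on `ℝ^d`: the Laplacian is symmetric against compactly supported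
functions. -/
lemma integral_lap_mul_eq_integral_mul_lap (hf : ContDiff ℝ 2 f) (hg : ContDiff ℝ 2 g)
    (hfc : HasCompactSupport f) :
    ∫ x, lap f x * g x = ∫ x, f x * lap g x := by
  simp only [lap, Finset.sum_mul, Finset.mul_sum]
  rw [integral_finsetSum, integral_finsetSum]
  · exact Finset.sum_congr rfl fun i _ =>
      integral_fderiv_fderiv_mul_of_hasCompactSupport volume hf hg hfc _
  · exact fun i _ => (hf.continuous.mul ((hg.fderiv_apply_const_of_two
      _).continuous_fderiv_apply_const _)).integrable_of_hasCompactSupport hfc.mul_right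
  · exact fun i _ => (((hf.fderiv_apply_const_of_two _).continuous_fderiv_apply_const
      _).mul hg.continuous).integrable_of_hasCompactSupport
      (HasCompactSupport.mul_right ((hfc.fderiv_apply ℝ _).fderiv_apply ℝ _))

end Laplacian

/-- The target density `p` integrates the formal generator of the regeneration-enriched
Brownian motion (with regeneration distribution `μ` and rate
`κ = Δp/(2p) + C μ/p`) to zero. -/
theorem stmt1 (d : ℕ) (hd : 1 ≤ d) (p μ : EuclideanSpace ℝ (Fin d) → ℝ)
    (hp_pos : ∀ x, 0 < p x) (hp_C2 : ContDiff ℝ 2 p) (hp_int : Integrable p)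
    (hΔp_int : Integrable (lap p)) (hΔp_zero : (∫ x, lap p x) = 0)
    (hμ_nonneg : ∀ x, 0 ≤ μ x) (hμ_int : Integrable μ) (hμ_one : (∫ x, μ x) = 1)
    (C : ℝ) (hC : 0 < C)
    (f : EuclideanSpace ℝ (Fin d) → ℝ) (hf : ContDiff ℝ 2 f)
    (hfc : HasCompactSupport f) :
    ∫ x, ((1 / 2) * lap f x
        + (lap p x / (2 * p x) + C * μ x / p x) * ((∫ y, f y * μ y) - f x)) * p x
      = 0 := by
  set m := ∫ y, f y * μ y with hm
  have hΔf_p : Integrable fun x => lap f x * p x :=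
    ((continuous_lap hf).mul hp_C2.continuous).integrable_of_hasCompactSupport
      (hasCompactSupport_lap hfc).mul_right
  have hf_Δp : Integrable fun x => f x * lap p x :=
    (hf.continuous.mul (continuous_lap hp_C2)).integrable_of_hasCompactSupport hfc.mul_right
  have hf_μ : Integrable fun x => f x * μ x := by
    obtain ⟨B, hB⟩ := hfc.exists_bound_of_continuous hf.continuous
    exact hμ_int.bdd_mul hf.continuous.aestronglyMeasurable (.of_forall hB)
  have hexpand : ∀ x, ((1 / 2) * lap f x
      + (lap p x / (2 * p x) + C * μ x / p x) * (m - f x)) * p x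
      = ((1 / 2) * (lap f x * p x) - (1 / 2) * (f x * lap p x)) + ((m / 2) * lap p x
        + (C * m * μ x - C * (f x * μ x))) := fun x => by
    have := (hp_pos x).ne'
    field_simp
    ring
  simp_rw [hexpand]
  have hμ_terms : Integrable fun x => C * m * μ x - C * (f x * μ x) :=
    (hμ_int.const_mul _).sub (hf_μ.const_mul _)
  have hgreen : Integrable fun x => (1 / 2) * (lap f x * p x) - (1 / 2) * (f x * lap p x) :=
    (hΔf_p.const_mul _).sub (hf_Δp.const_mul _)
  have hrest : Integrable fun x => (m / 2) * lap p x + (C * m * μ x - C * (f x * μ x)) :=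
    (hΔp_int.const_mul _).add hμ_terms
  rw [integral_add hgreen hrest, integral_sub (hΔf_p.const_mul _) (hf_Δp.const_mul _),
    integral_add (hΔp_int.const_mul _) hμ_terms,
    integral_sub (hμ_int.const_mul _) (hf_μ.const_mul _)]
  simp only [integral_const_mul]
  rw [integral_lap_mul_eq_integral_mul_lap hf hp_C2 hfc, hΔp_zero, hμ_one, ← hm]
  ring
end

section
/- Let (X, ℬ) be a measurable space, S a sub-Markov kernel on X (S(x, X) ≤ 1 for all x), and μ a probability measure on X with (μS)(X) > 0 and ∑_{n≥1} (μSⁿ)(X) < ∞. Define the finite measure ν := ∑_{n≥1} μSⁿ and the Markov kernel K_μ(x, A) := S(x, A) + (1 − S(x, X)) · (μS)(A)/(μS)(X). Then ν is invariant for K_μ: for every measurable A, ∫ K_μ(y, A) ν(dy) = ν(A). -/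
open MeasureTheory ProbabilityTheory

/-- The `n`-fold iterate of a kernel. -/
noncomputable def iterK {X : Type*} [MeasurableSpace X] (S : Kernel X X) :
    ℕ → Kernel X X
  | 0 => Kernel.id
  | n + 1 => Kernel.comp S (iterK S n)

/-- Integrating `S` against `μSⁿ` gives `μSⁿ⁺¹`. -/
lemma lintegral_bind_iterK {X : Type*} [MeasurableSpace X] (S : Kernel X X) (μ : Measure X)
    (n : ℕ) {A : Set X} (hA : MeasurableSet A) :
    ∫⁻ y, S y A ∂(μ.bind (fun x => (iterK S n) x))
      = (μ.bind (fun x => (iterK S (n + 1)) x)) A := by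
  rw [Measure.lintegral_bind (iterK S n).measurable.aemeasurable
      (S.measurable_coe hA).aemeasurable,
    Measure.bind_apply hA (iterK S (n + 1)).measurable.aemeasurable]
  exact lintegral_congr fun x => (Kernel.comp_apply' S (iterK S n) x hA).symm

/-- The occupation measure `ν = ∑_{n≥1} μSⁿ` satisfies `ν = μS + νS`. -/
lemma sum_bind_iterK_apply {X : Type*} [MeasurableSpace X] (S : Kernel X X) (μ : Measure X)
    {A : Set X} (hA : MeasurableSet A) :
    (Measure.sum (fun n : ℕ => μ.bind (fun x => (iterK S (n + 1)) x))) A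
      = ∫⁻ y, S y A ∂μ
        + ∫⁻ y, S y A ∂(Measure.sum (fun n : ℕ => μ.bind (fun x => (iterK S (n + 1)) x))) := by
  have h_zero : μ.bind (fun x => (iterK S 0) x) = μ := Measure.bind_dirac
  have h_first := lintegral_bind_iterK S μ 0 hA
  rw [h_zero] at h_first
  rw [lintegral_sum_measure, Measure.sum_apply _ hA, tsum_eq_zero_add' ENNReal.summable, h_first]
  simp only [lintegral_bind_iterK S μ _ hA]

/-- The finite measure `ν := ∑_{n≥1} μSⁿ` is invariant for the Markov kernel
`K_μ(x,A) := S(x,A) + (1 − S(x,X))·(μS)(A)/(μS)(X)`. -/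
theorem stmt5 {X : Type*} [MeasurableSpace X] (S : Kernel X X)
    (hS : ∀ x, S x Set.univ ≤ 1)
    (μ : Measure X) [IsProbabilityMeasure μ]
    (hpos : 0 < ∫⁻ y, S y Set.univ ∂μ)
    (hsum : (∑' n : ℕ, (μ.bind (fun x => (iterK S (n + 1)) x)) Set.univ) ≠ ⊤) :
    ∀ A : Set X, MeasurableSet A →
      ∫⁻ y, (S y A + (1 - S y Set.univ)
          * ((∫⁻ z, S z A ∂μ) / (∫⁻ z, S z Set.univ ∂μ)))
        ∂(Measure.sum (fun n : ℕ => μ.bind (fun x => (iterK S (n + 1)) x)))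
      = (Measure.sum (fun n : ℕ => μ.bind (fun x => (iterK S (n + 1)) x))) A := by
  intro A hA
  have hA_eq := sum_bind_iterK_apply S μ hA
  have h_univ := sum_bind_iterK_apply S μ MeasurableSet.univ
  rw [← Measure.sum_apply _ MeasurableSet.univ] at hsum
  set ν := Measure.sum (fun n : ℕ => μ.bind (fun x => (iterK S (n + 1)) x))
  have h_fin : ∫⁻ y, S y Set.univ ∂ν ≠ ⊤ :=
    ne_top_of_le_ne_top hsum (h_univ ▸ le_add_self)
  have h_mass : ∫⁻ y, S y Set.univ ∂μ ≠ ⊤ :=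
    ne_top_of_le_ne_top hsum (h_univ ▸ le_self_add)
  have h_defect : ∫⁻ y, (1 - S y Set.univ) ∂ν = ∫⁻ y, S y Set.univ ∂μ := by
    rw [lintegral_sub (S.measurable_coe MeasurableSet.univ) h_fin (ae_of_all _ hS),
      lintegral_one, h_univ, ENNReal.add_sub_cancel_right h_fin]
  have h_meas : Measurable fun y => 1 - S y Set.univ :=
    measurable_const.sub (S.measurable_coe MeasurableSet.univ)
  rw [lintegral_add_left (S.measurable_coe hA), lintegral_mul_const _ h_meas,
    h_defect, ENNReal.mul_div_cancel hpos.ne' h_mass, hA_eq, add_comm]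
end

section
/- Let (X, ℬ) be a measurable space, S a sub-Markov kernel on X (S(x, X) ≤ 1 for all x), and δ > 0. For any two probability measures μ, ν on X with (μS)(X) ≥ δ and (νS)(X) ≥ δ, the normalized measures satisfy ‖ μS/(μS)(X) − νS/(νS)(X) ‖_TV ≤ (2/δ) ‖ μ − ν ‖_TV, where ‖·‖_TV is the total variation norm ‖α‖_TV := sup{ |α(f)| : f measurable, ‖f‖_∞ ≤ 1 }. -/
open MeasureTheory ProbabilityTheory

/-- The total variation distance between two measures, defined as
`sup { |α(f) − β(f)| : f measurable, ‖f‖_∞ ≤ 1 }`. -/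
noncomputable def tvDist {X : Type*} [MeasurableSpace X]
    (α β : Measure X) : ℝ :=
  ⨆ f : {f : X → ℝ // Measurable f ∧ ∀ x, |f x| ≤ 1},
    |(∫ x, f.1 x ∂α) - ∫ x, f.1 x ∂β|

theorem abs_integral_le_measureReal_univ {X : Type*} [MeasurableSpace X] (α : Measure X)
    [IsFiniteMeasure α] {f : X → ℝ} (hf : ∀ x, |f x| ≤ 1) :
    |∫ x, f x ∂α| ≤ α.real Set.univ := by
  simpa using norm_integral_le_of_norm_le_const (μ := α) (f := f) (C := 1) (ae_of_all _ hf)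

theorem abs_integral_sub_integral_le_tvDist {X : Type*} [MeasurableSpace X] (α β : Measure X)
    [IsFiniteMeasure α] [IsFiniteMeasure β] {f : X → ℝ} (hf : Measurable f)
    (hf1 : ∀ x, |f x| ≤ 1) :
    |(∫ x, f x ∂α) - ∫ x, f x ∂β| ≤ tvDist α β := by
  have hbdd : BddAbove (Set.range fun f : {f : X → ℝ // Measurable f ∧ ∀ x, |f x| ≤ 1} =>
      |(∫ x, f.1 x ∂α) - ∫ x, f.1 x ∂β|) := by
    refine ⟨α.real Set.univ + β.real Set.univ, ?_⟩
    rintro _ ⟨g, rfl⟩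
    exact (abs_sub _ _).trans (add_le_add (abs_integral_le_measureReal_univ α g.2.2)
      (abs_integral_le_measureReal_univ β g.2.2))
  exact le_ciSup hbdd ⟨f, hf, hf1⟩

/-- A sub-Markov kernel does not increase the total variation distance. -/
theorem abs_integral_bind_sub_integral_bind_le_tvDist {X : Type*} [MeasurableSpace X]
    (S : Kernel X X) [IsFiniteKernel S] (hS : ∀ x, S x Set.univ ≤ 1) (μ ν : Measure X)
    [IsFiniteMeasure μ] [IsFiniteMeasure ν] {f : X → ℝ} (hf : Measurable f)
    (hf1 : ∀ x, |f x| ≤ 1) :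
    |(∫ x, f x ∂(μ.bind S)) - ∫ x, f x ∂(ν.bind S)| ≤ tvDist μ ν := by
  have hint : ∀ (α : Measure X) [IsFiniteMeasure α], Integrable f α := fun α _ =>
    Integrable.of_bound hf.aestronglyMeasurable 1 (ae_of_all _ hf1)
  have hbind : ∀ (α : Measure X) [IsFiniteMeasure α],
      ∫ x, f x ∂(α.bind S) = ∫ x, ∫ y, f y ∂(S x) ∂α := fun α _ => by
    rw [Measure.comp_eq_comp_const_apply, Kernel.integral_comp (hint _), Kernel.const_apply]
  rw [hbind μ, hbind ν]
  refine abs_integral_sub_integral_le_tvDist μ ν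
    hf.stronglyMeasurable.integral_kernel.measurable fun x => ?_
  refine (abs_integral_le_measureReal_univ (S x) hf1).trans ?_
  exact ENNReal.toReal_le_of_le_ofReal zero_le_one (by simpa using hS x)

/-- Stability of quotients `A / a` with `|B| ≤ b` under perturbations of size at most `t`. -/
theorem abs_div_sub_div_le {A B a b δ t : ℝ} (hδ : 0 < δ) (ha : δ ≤ a) (hb : 0 < b)
    (hB : |B| ≤ b) (hAB : |A - B| ≤ t) (hab : |a - b| ≤ t) :
    |A / a - B / b| ≤ 2 / δ * t := by
  have ha0 : 0 < a := hδ.trans_le ha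
  have ht : 0 ≤ t := (abs_nonneg _).trans hab
  have hBb : |B / b| ≤ 1 := by
    rw [abs_div, abs_of_pos hb]
    exact div_le_one_of_le₀ hB hb.le
  have key : A / a - B / b = ((A - B) - B / b * (a - b)) / a := by
    field_simp
    ring
  rw [key, abs_div, abs_of_pos ha0]
  calc |(A - B) - B / b * (a - b)| / a ≤ (t + 1 * t) / a := by
        gcongr
        refine (abs_sub _ _).trans ?_
        rw [abs_mul]
        gcongr
    _ ≤ (t + 1 * t) / δ := by gcongr
    _ = 2 / δ * t := by ring

/-- For a sub-Markov kernel `S` and probability measures `μ, ν` with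
`(μS)(X), (νS)(X) ≥ δ > 0`, the normalized measures satisfy
`‖μS/(μS)(X) − νS/(νS)(X)‖_TV ≤ (2/δ)‖μ − ν‖_TV`. -/
theorem stmt6 {X : Type*} [MeasurableSpace X] (S : Kernel X X)
    (hS : ∀ x, S x Set.univ ≤ 1)
    (δ : ℝ) (hδ : 0 < δ)
    (μ ν : Measure X) [IsProbabilityMeasure μ] [IsProbabilityMeasure ν]
    (hμ : ENNReal.ofReal δ ≤ (μ.bind (fun x => S x)) Set.univ)
    (hν : ENNReal.ofReal δ ≤ (ν.bind (fun x => S x)) Set.univ) :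
    tvDist (((μ.bind (fun x => S x)) Set.univ)⁻¹ • (μ.bind (fun x => S x)))
        (((ν.bind (fun x => S x)) Set.univ)⁻¹ • (ν.bind (fun x => S x)))
      ≤ (2 / δ) * tvDist μ ν := by
  have : IsFiniteKernel S := ⟨1, ENNReal.one_lt_top, hS⟩
  have hreal : ∀ (α : Measure X) [IsFiniteMeasure α],
      ENNReal.ofReal δ ≤ α Set.univ → δ ≤ α.real Set.univ := fun α _ h =>
    (ENNReal.ofReal_le_iff_le_toReal (measure_ne_top α _)).1 h
  have : Nonempty {f : X → ℝ // Measurable f ∧ ∀ x, |f x| ≤ 1} :=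
    ⟨⟨fun _ => 0, measurable_const, by simp⟩⟩
  refine ciSup_le fun ⟨f, hf, hf1⟩ => ?_
  have hmass := abs_integral_bind_sub_integral_bind_le_tvDist S hS μ ν
    (f := fun _ => 1) measurable_const (by simp)
  simp only [integral_const, smul_eq_mul, mul_one] at hmass
  simp only [integral_smul_measure, ENNReal.toReal_inv, smul_eq_mul, inv_mul_eq_div]
  exact abs_div_sub_div_le hδ (hreal (μ.bind S) hμ) (hδ.trans_le (hreal (ν.bind S) hν))
    (abs_integral_le_measureReal_univ (ν.bind S) hf1)
    (abs_integral_bind_sub_integral_bind_le_tvDist S hS μ ν hf hf1) hmass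
end

section
/- Let (X, ℬ) be a measurable space, S a sub-Markov kernel on X, δ > 0, and μ, ν probability measures on X with (μS)(X) ≥ δ and (νS)(X) ≥ δ. Define the Markov kernels K_μ(x, A) := S(x, A) + (1 − S(x, X)) (μS)(A)/(μS)(X) and K_ν(x, A) := S(x, A) + (1 − S(x, X)) (νS)(A)/(νS)(X). Then for every j ≥ 1 and every probability measure α on X, ‖ α K_μ^j − α K_ν^j ‖_TV ≤ (2/δ) · 2^j · ‖ μ − ν ‖_TV. -/
open MeasureTheory ProbabilityTheory

/-- Iterates of a Markov kernel are Markov. -/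
instance iterK.instIsMarkovKernel {X : Type*} [MeasurableSpace X] (K : Kernel X X)
    [IsMarkovKernel K] (n : ℕ) : IsMarkovKernel (iterK K n) := by
  induction n with
  | zero => rw [iterK]; infer_instance
  | succ n ih => rw [iterK]; infer_instance

lemma integrable_of_abs_le_one {X : Type*} [MeasurableSpace X] (μ : Measure X)
    [IsFiniteMeasure μ] {f : X → ℝ} (hf : Measurable f) (hb : ∀ x, |f x| ≤ 1) :
    Integrable f μ :=
  Integrable.of_bound hf.aestronglyMeasurable 1 (ae_of_all _ hb)

lemma abs_integral_le_of_abs_le {X : Type*} [MeasurableSpace X] (μ : Measure X)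
    [IsFiniteMeasure μ] {f : X → ℝ} {C : ℝ} (hb : ∀ x, |f x| ≤ C) :
    |∫ x, f x ∂μ| ≤ C * μ.real Set.univ := by
  rw [← Real.norm_eq_abs]
  exact norm_integral_le_of_norm_le_const (ae_of_all _ hb)

lemma integral_bind_kernel {X Y : Type*} [MeasurableSpace X] [MeasurableSpace Y]
    (μ : Measure X) [IsFiniteMeasure μ] (κ : Kernel X Y) [IsFiniteKernel κ]
    {f : Y → ℝ} (hf : Measurable f) (hb : ∀ y, |f y| ≤ 1) :
    ∫ y, f y ∂(μ.bind κ) = ∫ x, ∫ y, f y ∂(κ x) ∂μ := by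
  have h := Kernel.integral_comp (η := κ) (κ := Kernel.const Unit μ) (a := ())
    (integrable_of_abs_le_one _ hf hb)
  rwa [Kernel.comp_apply, Kernel.const_apply] at h

lemma measurable_integral_kernel {X Y : Type*} [MeasurableSpace X] [MeasurableSpace Y]
    (κ : Kernel X Y) {f : Y → ℝ} (hf : Measurable f) :
    Measurable fun x => ∫ y, f y ∂(κ x) :=
  (hf.stronglyMeasurable.integral_kernel (κ := κ)).measurable

lemma abs_integral_le_one {X : Type*} [MeasurableSpace X] (μ : Measure X)
    (hμ : μ Set.univ ≤ 1) {f : X → ℝ} (hb : ∀ x, |f x| ≤ 1) :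
    |∫ x, f x ∂μ| ≤ 1 := by
  have : IsFiniteMeasure μ := ⟨hμ.trans_lt ENNReal.one_lt_top⟩
  refine (abs_integral_le_of_abs_le μ hb).trans ?_
  rw [one_mul]
  exact ENNReal.toReal_le_of_le_ofReal zero_le_one (by simpa using hμ)

lemma abs_integral_sub_le_tvDist {X : Type*} [MeasurableSpace X] (μ ν : Measure X)
    [IsFiniteMeasure μ] [IsFiniteMeasure ν] {f : X → ℝ} (hf : Measurable f)
    (hb : ∀ x, |f x| ≤ 1) :
    |(∫ x, f x ∂μ) - ∫ x, f x ∂ν| ≤ tvDist μ ν := by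
  refine le_ciSup (f := fun f : {f : X → ℝ // Measurable f ∧ ∀ x, |f x| ≤ 1} =>
    |(∫ x, f.1 x ∂μ) - ∫ x, f.1 x ∂ν|) ⟨μ.real Set.univ + ν.real Set.univ, ?_⟩ ⟨f, hf, hb⟩
  rintro _ ⟨g, rfl⟩
  refine (abs_sub _ _).trans (add_le_add ?_ ?_)
  · simpa using abs_integral_le_of_abs_le μ g.2.2
  · simpa using abs_integral_le_of_abs_le ν g.2.2

lemma tvDist_nonneg {X : Type*} [MeasurableSpace X] (μ ν : Measure X) : 0 ≤ tvDist μ ν :=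
  Real.iSup_nonneg fun _ => abs_nonneg _

/-- If two Markov kernels are pointwise `c`-close, then their `n`-fold iterates are
pointwise `n * c`-close. -/
lemma abs_integral_iterK_sub_le {X : Type*} [MeasurableSpace X] (K L : Kernel X X)
    [IsMarkovKernel K] [IsMarkovKernel L] {c : ℝ}
    (h : ∀ f : X → ℝ, Measurable f → (∀ x, |f x| ≤ 1) →
      ∀ x, |(∫ y, f y ∂(K x)) - ∫ y, f y ∂(L x)| ≤ c)
    (n : ℕ) {f : X → ℝ} (hf : Measurable f) (hb : ∀ x, |f x| ≤ 1) (x : X) :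
    |(∫ y, f y ∂(iterK K n x)) - ∫ y, f y ∂(iterK L n x)| ≤ n * c := by
  induction n generalizing f with
  | zero => simp [iterK]
  | succ n ih =>
    have hKm := measurable_integral_kernel K hf
    have hLm := measurable_integral_kernel L hf
    have hKb : ∀ z, |∫ y, f y ∂(K z)| ≤ 1 := fun z => abs_integral_le_one _ prob_le_one hb
    have hLb : ∀ z, |∫ y, f y ∂(L z)| ≤ 1 := fun z => abs_integral_le_one _ prob_le_one hb
    simp only [iterK, Kernel.comp_apply]
    rw [integral_bind_kernel _ K hf hb, integral_bind_kernel _ L hf hb]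
    have hsub : |(∫ z, ∫ y, f y ∂(K z) ∂(iterK L n x)) - ∫ z, ∫ y, f y ∂(L z) ∂(iterK L n x)|
        ≤ c := by
      rw [← integral_sub (integrable_of_abs_le_one _ hKm hKb)
        (integrable_of_abs_le_one _ hLm hLb)]
      simpa using abs_integral_le_of_abs_le (iterK L n x) (h f hf hb)
    refine (abs_sub_le _ _ _).trans ((add_le_add (ih hKm hKb) hsub).trans_eq ?_)
    push_cast
    ring

lemma tvDist_bind_le {X Y : Type*} [MeasurableSpace X] [MeasurableSpace Y] (α : Measure X)
    [IsProbabilityMeasure α] (K L : Kernel X Y) [IsMarkovKernel K] [IsMarkovKernel L] {c : ℝ}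
    (h : ∀ f : Y → ℝ, Measurable f → (∀ y, |f y| ≤ 1) →
      ∀ x, |(∫ y, f y ∂(K x)) - ∫ y, f y ∂(L x)| ≤ c) :
    tvDist (α.bind K) (α.bind L) ≤ c := by
  have : Nonempty {f : Y → ℝ // Measurable f ∧ ∀ y, |f y| ≤ 1} :=
    ⟨⟨fun _ => 0, measurable_const, by simp⟩⟩
  refine ciSup_le ?_
  rintro ⟨f, hf, hb⟩
  rw [integral_bind_kernel _ K hf hb, integral_bind_kernel _ L hf hb,
    ← integral_sub
      (integrable_of_abs_le_one _ (measurable_integral_kernel K hf)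
        fun z => abs_integral_le_one _ prob_le_one hb)
      (integrable_of_abs_le_one _ (measurable_integral_kernel L hf)
        fun z => abs_integral_le_one _ prob_le_one hb)]
  simpa using abs_integral_le_of_abs_le α (h f hf hb)

/-- The integral against a measure `σ + (1 - σ(X)) ρ / ρ(X)`, where `σ` is sub-Markov. -/
lemma integral_of_eq_add_normalized {X : Type*} [MeasurableSpace X] {κ σ ρ : Measure X}
    [IsFiniteMeasure σ] [IsFiniteMeasure ρ] (hσ : σ Set.univ ≤ 1) (hρ : ρ Set.univ ≠ 0)
    (h : ∀ A : Set X, MeasurableSet A →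
      κ A = σ A + (1 - σ Set.univ) * (ρ A / ρ Set.univ))
    {f : X → ℝ} (hf : Measurable f) (hb : ∀ x, |f x| ≤ 1) :
    ∫ x, f x ∂κ
      = ∫ x, f x ∂σ + (1 - σ.real Set.univ) * ((∫ x, f x ∂ρ) / ρ.real Set.univ) := by
  have hκ : κ = σ + ((1 - σ Set.univ) * (ρ Set.univ)⁻¹) • ρ := by
    ext A hA
    rw [h A hA, Measure.add_apply, Measure.smul_apply, smul_eq_mul, ENNReal.div_eq_inv_mul,
      mul_assoc]
  have hc : (1 - σ Set.univ) * (ρ Set.univ)⁻¹ ≠ ⊤ :=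
    ENNReal.mul_ne_top (by finiteness) (ENNReal.inv_ne_top.2 hρ)
  rw [hκ, integral_add_measure (integrable_of_abs_le_one _ hf hb)
    ((integrable_of_abs_le_one _ hf hb).smul_measure hc), integral_smul_measure, smul_eq_mul,
    ENNReal.toReal_mul, ENNReal.toReal_inv, ENNReal.toReal_sub_of_le hσ ENNReal.one_ne_top,
    ENNReal.toReal_one]
  simp only [Measure.real]
  ring

lemma abs_div_sub_div_le_s7 {a b m n d δ : ℝ} (hδ : 0 < δ) (hm : δ ≤ m) (hn : δ ≤ n)
    (hab : |a - b| ≤ d) (hmn : |m - n| ≤ d) (hb : |b| ≤ n) :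
    |a / m - b / n| ≤ 2 / δ * d := by
  have hm0 : 0 < m := hδ.trans_le hm
  have hn0 : 0 < n := hδ.trans_le hn
  have hd : 0 ≤ d := (abs_nonneg _).trans hab
  have hbn : |b / n| ≤ 1 := by
    rw [abs_div, abs_of_pos hn0]
    exact (div_le_one hn0).2 hb
  have heq : a / m - b / n = ((a - b) - b / n * (m - n)) / m := by
    field_simp
    ring
  have hnum : |(a - b) - b / n * (m - n)| ≤ 2 * d := by
    refine (abs_sub _ _).trans ?_
    rw [abs_mul]
    nlinarith [mul_le_mul hbn hmn (abs_nonneg _) zero_le_one]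
  rw [heq, abs_div, abs_of_pos hm0]
  calc _ ≤ 2 * d / δ := div_le_div₀ (by positivity) hnum hδ hm
    _ = 2 / δ * d := by ring

/-- Lipschitz property of the iterated rebirth kernels: for the Markov kernels
`K_μ(x,A) = S(x,A) + (1 − S(x,X))·(μS)(A)/(μS)(X)` and `K_ν` (analogously),
`‖αK_μ^j − αK_ν^j‖_TV ≤ (2/δ)·2^j·‖μ − ν‖_TV`. -/
theorem stmt7 {X : Type*} [MeasurableSpace X] (S : Kernel X X)
    (hS : ∀ x, S x Set.univ ≤ 1)
    (δ : ℝ) (hδ : 0 < δ)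
    (μ ν : Measure X) [IsProbabilityMeasure μ] [IsProbabilityMeasure ν]
    (hμ : ENNReal.ofReal δ ≤ (μ.bind (fun x => S x)) Set.univ)
    (hν : ENNReal.ofReal δ ≤ (ν.bind (fun x => S x)) Set.univ)
    (Kμ Kν : Kernel X X) [IsMarkovKernel Kμ] [IsMarkovKernel Kν]
    (hKμ : ∀ x (A : Set X), MeasurableSet A →
      Kμ x A = S x A + (1 - S x Set.univ)
        * ((μ.bind (fun z => S z)) A / (μ.bind (fun z => S z)) Set.univ))
    (hKν : ∀ x (A : Set X), MeasurableSet A →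
      Kν x A = S x A + (1 - S x Set.univ)
        * ((ν.bind (fun z => S z)) A / (ν.bind (fun z => S z)) Set.univ))
    (j : ℕ) (hj : 1 ≤ j)
    (α : Measure X) [IsProbabilityMeasure α] :
    tvDist (α.bind (fun x => (iterK Kμ j) x)) (α.bind (fun x => (iterK Kν j) x))
      ≤ (2 / δ) * 2 ^ j * tvDist μ ν := by
  have : IsFiniteKernel S := ⟨1, ENNReal.one_lt_top, hS⟩
  have hpos : 0 < ENNReal.ofReal δ := ENNReal.ofReal_pos.2 hδ
  have hδμ : δ ≤ (μ.bind S).real Set.univ :=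
    (ENNReal.ofReal_le_iff_le_toReal (measure_ne_top _ _)).1 hμ
  have hδν : δ ≤ (ν.bind S).real Set.univ :=
    (ENNReal.ofReal_le_iff_le_toReal (measure_ne_top _ _)).1 hν
  have hbind : ∀ f : X → ℝ, Measurable f → (∀ x, |f x| ≤ 1) →
      |(∫ x, f x ∂(μ.bind S)) - ∫ x, f x ∂(ν.bind S)| ≤ tvDist μ ν := by
    intro f hf hb
    rw [integral_bind_kernel _ S hf hb, integral_bind_kernel _ S hf hb]
    exact abs_integral_sub_le_tvDist μ ν (measurable_integral_kernel S hf)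
      fun x => abs_integral_le_one _ (hS x) hb
  have hstep : ∀ f : X → ℝ, Measurable f → (∀ x, |f x| ≤ 1) →
      ∀ x, |(∫ y, f y ∂(Kμ x)) - ∫ y, f y ∂(Kν x)| ≤ 2 / δ * tvDist μ ν := by
    intro f hf hb x
    rw [integral_of_eq_add_normalized (hS x) (hpos.trans_le hμ).ne' (hKμ x) hf hb,
      integral_of_eq_add_normalized (hS x) (hpos.trans_le hν).ne' (hKν x) hf hb,
      add_sub_add_left_eq_sub, ← mul_sub, abs_mul]
    have hSx : (S x).real Set.univ ≤ 1 :=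
      ENNReal.toReal_le_of_le_ofReal zero_le_one (by simpa using hS x)
    have hfac : |1 - (S x).real Set.univ| ≤ 1 := by
      rw [abs_of_nonneg (by linarith)]
      linarith [measureReal_nonneg (μ := S x) (s := Set.univ)]
    refine (mul_le_of_le_one_left (abs_nonneg _) hfac).trans ?_
    refine abs_div_sub_div_le_s7 hδ hδμ hδν (hbind f hf hb) ?_ ?_
    · simpa using hbind (fun _ => 1) measurable_const (by simp)
    · simpa using abs_integral_le_of_abs_le (ν.bind S) hb
  refine (tvDist_bind_le α (iterK Kμ j) (iterK Kν j)
    fun f hf hb x => abs_integral_iterK_sub_le Kμ Kν hstep j hf hb x).trans ?_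
  have hj2 : (j : ℝ) ≤ 2 ^ j := by exact_mod_cast Nat.lt_two_pow_self.le
  have hd := tvDist_nonneg μ ν
  calc (j : ℝ) * (2 / δ * tvDist μ ν) ≤ 2 ^ j * (2 / δ * tvDist μ ν) := by gcongr
    _ = 2 / δ * 2 ^ j * tvDist μ ν := by ring
end
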